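/- Let K ≥ 2. For t = (t_1,…,t_K) ∈ (0,1]^K define f_t on Δ_K := { π ∈ ℝ^K : π_i ≥ 0, Σ_i π_i = 1 } by f_t(π) = (∏_{i=1}^K t_i·π_i) / (1 + Σ_{j=1}^K ∏_{i=1}^j t_i·π_i), and let π*(t) ∈ Δ_K denote its (unique) maximizer over Δ_K. Then for every finite collection A_1, …, A_n of affine subspaces of ℝ^K, each of dimension at most K−2, there exists t ∈ (0,1]^K such that π*(t) ∉ A_1 ∪ ⋯ ∪ A_n. (The set of optimal policies, as t varies, is not contained in any finite union of (K−2)-dimensional affine subspaces.) -/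

import Mathlib

open Finset in
lemma aux_prod (s : Finset ℕ) (r : ℕ → ℝ) (hr : ∀ i ∈ s, 0 < r i) :
    1 + ∑ i ∈ s, (1 - r i) ≤ ∏ i ∈ s, (r i)⁻¹ := by
  have h1 : ∏ i ∈ s, (r i)⁻¹ = Real.exp (∑ i ∈ s, - Real.log (r i)) := by
    rw [Real.exp_sum]
    refine Finset.prod_congr rfl fun i hi => ?_
    rw [Real.exp_neg, Real.exp_log (hr i hi)]
  have h2 : ∑ i ∈ s, (1 - r i) ≤ ∑ i ∈ s, - Real.log (r i) := by
    refine Finset.sum_le_sum fun i hi => ?_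
    have := Real.log_le_sub_one_of_pos (hr i hi)
    linarith
  have h3 := Real.add_one_le_exp (∑ i ∈ s, - Real.log (r i))
  rw [h1]; linarith

lemma aux_prod_lt (s : Finset ℕ) (r : ℕ → ℝ) (hr : ∀ i ∈ s, 0 < r i)
    (hne : ∃ i ∈ s, r i ≠ 1) :
    1 + ∑ i ∈ s, (1 - r i) < ∏ i ∈ s, (r i)⁻¹ := by
  have h1 : ∏ i ∈ s, (r i)⁻¹ = Real.exp (∑ i ∈ s, - Real.log (r i)) := by
    rw [Real.exp_sum]
    refine Finset.prod_congr rfl fun i hi => ?_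
    rw [Real.exp_neg, Real.exp_log (hr i hi)]
  have h2 : ∑ i ∈ s, (1 - r i) < ∑ i ∈ s, - Real.log (r i) := by
    obtain ⟨i, hi, hi1⟩ := hne
    refine Finset.sum_lt_sum (fun i hi => ?_) ⟨i, hi, ?_⟩
    · have := Real.log_le_sub_one_of_pos (hr i hi)
      linarith
    · have := Real.log_lt_sub_one_of_pos (hr i hi) hi1
      linarith
  have h3 := Real.add_one_le_exp (∑ i ∈ s, - Real.log (r i))
  rw [h1]; linarith

lemma aux_sum (G : ℕ → ℝ) (K : ℕ) :
    ∑ j ∈ Finset.range (K + 1), G j = G 0 + ∑ j ∈ Finset.Icc 1 K, G j := by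
  induction K with
  | zero => simp
  | succ k ih => rw [Finset.sum_range_succ, ih, Finset.sum_Icc_succ_top (by omega)]; ring

lemma aux_swap (W u : ℕ → ℝ) (K : ℕ) :
    ∑ j ∈ Finset.range (K + 1), W j * ∑ i ∈ Finset.Ioc j K, u i
      = ∑ i ∈ Finset.Icc 1 K, u i * ∑ j ∈ Finset.range i, W j := by
  simp_rw [Finset.mul_sum]
  rw [Finset.sum_comm' (s := Finset.range (K+1)) (t := fun j => Finset.Ioc j K)
    (t' := Finset.Icc 1 K) (s' := fun i => Finset.range i)]
  · exact Finset.sum_congr rfl fun i _ => Finset.sum_congr rfl fun j _ => mul_comm _ _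
  · intro x y; simp only [Finset.mem_range, Finset.mem_Ioc, Finset.mem_Icc]; omega

lemma aux_split (b : ℕ → ℝ) (j K : ℕ) (h : j ≤ K) :
    ∏ i ∈ Finset.Icc 1 K, b i = (∏ i ∈ Finset.Icc 1 j, b i) * ∏ i ∈ Finset.Ioc j K, b i := by
  induction K, h using Nat.le_induction with
  | base => simp
  | succ k hk ih =>
    rw [Finset.prod_Icc_succ_top (by omega), ih, Finset.prod_Ioc_succ_top hk, mul_assoc]

/-- Any maximizer coincides with the explicit critical point `p`. -/
lemma aux_core (K : ℕ) (hK : 1 ≤ K) (p t ρ : ℕ → ℝ) (hp0 : p 0 = 0)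
    (hp : ∀ j < K, p j < p (j + 1)) (hps : ∑ i ∈ Finset.Icc 1 K, p i = 1)
    (ht : ∀ i ∈ Finset.Icc 1 K, 0 < t i)
    (htp : ∀ j, j + 1 < K → t (j + 1) * p (j + 1) * (p (j + 1) - p j) = p (j + 2) - p (j + 1))
    (hρ : ∀ i ∈ Finset.Icc 1 K, 0 ≤ ρ i) (hρs : ∑ i ∈ Finset.Icc 1 K, ρ i = 1)
    (hmax : (∏ i ∈ Finset.Icc 1 K, t i * p i) /
              (1 + ∑ j ∈ Finset.Icc 1 K, ∏ i ∈ Finset.Icc 1 j, t i * p i)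
            ≤ (∏ i ∈ Finset.Icc 1 K, t i * ρ i) /
              (1 + ∑ j ∈ Finset.Icc 1 K, ∏ i ∈ Finset.Icc 1 j, t i * ρ i)) :
    ∀ i ∈ Finset.Icc 1 K, ρ i = p i := by
  have hppos : ∀ j, j < K → 0 < p (j + 1) := by
    intro j
    induction j with
    | zero => intro h; have := hp 0 h; rwa [hp0] at this
    | succ k ih => intro h; exact (ih (by omega)).trans (hp _ h)
  have hpI : ∀ i ∈ Finset.Icc 1 K, 0 < p i := by
    intro i hi
    simp only [Finset.mem_Icc] at hi
    have := hppos (i - 1) (by omega)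
    rwa [Nat.sub_add_cancel hi.1] at this
  set W : ℕ → ℝ := fun j => ∏ i ∈ Finset.Icc 1 j, t i * p i with hW
  set R : ℕ → ℝ := fun j => ∏ i ∈ Finset.Icc 1 j, t i * ρ i with hR
  have hWpos : ∀ j ≤ K, 0 < W j := by
    intro j hj
    refine Finset.prod_pos fun i hi => ?_
    have hi' : i ∈ Finset.Icc 1 K := by simp only [Finset.mem_Icc] at hi ⊢; omega
    exact mul_pos (ht i hi') (hpI i hi')
  have hRnn : ∀ j ≤ K, 0 ≤ R j := by
    intro j hj
    refine Finset.prod_nonneg fun i hi => ?_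
    have hi' : i ∈ Finset.Icc 1 K := by simp only [Finset.mem_Icc] at hi ⊢; omega
    exact mul_nonneg (ht i hi').le (hρ i hi')
  have hDW : 0 < 1 + ∑ j ∈ Finset.Icc 1 K, W j := by
    have : 0 ≤ ∑ j ∈ Finset.Icc 1 K, W j :=
      Finset.sum_nonneg fun j hj => (hWpos j (Finset.mem_Icc.1 hj).2).le
    linarith
  have hDR : 0 < 1 + ∑ j ∈ Finset.Icc 1 K, R j := by
    have : 0 ≤ ∑ j ∈ Finset.Icc 1 K, R j :=
      Finset.sum_nonneg fun j hj => (hRnn j (Finset.mem_Icc.1 hj).2)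
    linarith
  have hmax' : W K / (1 + ∑ j ∈ Finset.Icc 1 K, W j) ≤ R K / (1 + ∑ j ∈ Finset.Icc 1 K, R j) := hmax
  have hRK : 0 < R K := by
    have h1 : 0 < R K / (1 + ∑ j ∈ Finset.Icc 1 K, R j) :=
      lt_of_lt_of_le (div_pos (hWpos K le_rfl) hDW) hmax'
    rcases (hRnn K le_rfl).lt_or_eq with h | h
    · exact h
    · rw [← h] at h1; simp at h1
  have hρpos : ∀ i ∈ Finset.Icc 1 K, 0 < ρ i := by
    intro i hi
    refine lt_of_le_of_ne (hρ i hi) fun h => ?_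
    have : R K = 0 := Finset.prod_eq_zero hi (by rw [← h, mul_zero])
    linarith
  rw [div_le_div_iff₀ hDW hDR] at hmax'
  have hW0 : W 0 = 1 := by simp [hW]
  have hR0 : R 0 = 1 := by simp [hR]
  have eW := aux_sum W K
  have eR := aux_sum R K
  rw [hW0] at eW
  rw [hR0] at eR
  rw [← eW, ← eR] at hmax'
  have hWt : ∀ j < K, W j * p 1 = p (j + 1) - p j := by
    intro j
    induction j with
    | zero => intro _; simp [hW0, hp0]
    | succ k ih =>
      intro h
      have h1 : W (k + 1) = W k * (t (k + 1) * p (k + 1)) :=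
        Finset.prod_Icc_succ_top (by omega) _
      have h2 := ih (by omega)
      have h3 := htp k h
      rw [h1]
      calc W k * (t (k + 1) * p (k + 1)) * p 1
          = t (k + 1) * p (k + 1) * (W k * p 1) := by ring
        _ = p (k + 1 + 1) - p (k + 1) := by rw [h2, h3]
  have hWs : ∀ i ≤ K, (∑ j ∈ Finset.range i, W j) * p 1 = p i := by
    intro i hi
    rw [Finset.sum_mul, Finset.sum_congr rfl
      (fun j hj => hWt j (by have := Finset.mem_range.1 hj; omega)),
      Finset.sum_range_sub, hp0, sub_zero]
  have hp1 : 0 < p 1 := hppos 0 (by omega)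
  set r : ℕ → ℝ := fun i => ρ i / p i with hr
  have hrpos : ∀ i ∈ Finset.Icc 1 K, 0 < r i := fun i hi => div_pos (hρpos i hi) (hpI i hi)
  have hterm : ∀ j ≤ K, R j * W K = R K * (W j * ∏ i ∈ Finset.Ioc j K, (r i)⁻¹) := by
    intro j hj
    have h1 : R K = R j * ∏ i ∈ Finset.Ioc j K, t i * ρ i := aux_split _ j K hj
    have h2 : W K = W j * ∏ i ∈ Finset.Ioc j K, t i * p i := aux_split _ j K hj
    have h3 : ∏ i ∈ Finset.Ioc j K, t i * p i
        = (∏ i ∈ Finset.Ioc j K, t i * ρ i) * ∏ i ∈ Finset.Ioc j K, (r i)⁻¹ := by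
      rw [← Finset.prod_mul_distrib]
      refine Finset.prod_congr rfl fun i hi => ?_
      have hi' : i ∈ Finset.Icc 1 K := by
        simp only [Finset.mem_Ioc, Finset.mem_Icc] at hi ⊢; omega
      have := hρpos i hi'
      have := hpI i hi'
      simp only [hr]
      field_simp
    rw [h1, h2, h3]; ring
  by_contra hcon
  push Not at hcon
  obtain ⟨i₀, hi₀, hne⟩ := hcon
  have hstrict : ∑ j ∈ Finset.range (K + 1), W j * (1 + ∑ i ∈ Finset.Ioc j K, (1 - r i))
      < ∑ j ∈ Finset.range (K + 1), W j * ∏ i ∈ Finset.Ioc j K, (r i)⁻¹ := by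
    refine Finset.sum_lt_sum (fun j hj => ?_) ⟨0, by simp, ?_⟩
    · have hj' : j ≤ K := by have := Finset.mem_range.1 hj; omega
      refine mul_le_mul_of_nonneg_left (aux_prod _ _ fun i hi => hrpos i ?_) (hWpos j hj').le
      simp only [Finset.mem_Ioc, Finset.mem_Icc] at hi ⊢; omega
    · refine mul_lt_mul_of_pos_left (aux_prod_lt _ _ (fun i hi => hrpos i ?_) ⟨i₀, ?_, ?_⟩)
        (hWpos 0 (by omega))
      · simp only [Finset.mem_Ioc, Finset.mem_Icc] at hi ⊢; omega
      · simp only [Finset.mem_Ioc, Finset.mem_Icc] at hi₀ ⊢; omega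
      · intro h
        simp only [hr] at h
        rw [div_eq_one_iff_eq (hpI i₀ hi₀).ne'] at h
        exact hne h
  have hzero : ∑ j ∈ Finset.range (K + 1), W j * ∑ i ∈ Finset.Ioc j K, (1 - r i) = 0 := by
    rw [aux_swap]
    have : ∀ i ∈ Finset.Icc 1 K, (1 - r i) * ∑ j ∈ Finset.range i, W j = (p i - ρ i) / p 1 := by
      intro i hi
      have h1 := hWs i (Finset.mem_Icc.1 hi).2
      have h2 := hpI i hi
      rw [eq_div_iff hp1.ne', mul_assoc, h1]
      simp only [hr]
      field_simp
    rw [Finset.sum_congr rfl this, ← Finset.sum_div, Finset.sum_sub_distrib, hps, hρs]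
    simp
  have hlow : ∑ j ∈ Finset.range (K + 1), W j * (1 + ∑ i ∈ Finset.Ioc j K, (1 - r i))
      = ∑ j ∈ Finset.range (K + 1), W j := by
    simp_rw [mul_add, mul_one]
    rw [Finset.sum_add_distrib, hzero, add_zero]
  rw [hlow] at hstrict
  have h5 := mul_lt_mul_of_pos_left hstrict hRK
  have h6 : R K * ∑ j ∈ Finset.range (K + 1), W j * ∏ i ∈ Finset.Ioc j K, (r i)⁻¹
      = W K * ∑ j ∈ Finset.range (K + 1), R j := by
    rw [Finset.mul_sum, Finset.mul_sum]
    refine Finset.sum_congr rfl fun j hj => ?_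
    rw [← hterm j (by have := Finset.mem_range.1 hj; omega), mul_comm]
  rw [h6] at h5
  linarith

/-- Extension of a vector to a sequence indexed from `1`, zero elsewhere. -/
def auxExt (K : ℕ) (x : Fin K → ℝ) (i : ℕ) : ℝ :=
  if h : 1 ≤ i ∧ i ≤ K then x ⟨i - 1, by omega⟩ else 0

lemma auxExt_cont (K i : ℕ) : Continuous fun x : Fin K → ℝ => auxExt K x i := by
  unfold auxExt
  by_cases h : 1 ≤ i ∧ i ≤ K
  · simp only [h, and_self, dite_true]; exact continuous_apply _
  · simp only [h, dite_false]; exact continuous_const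

lemma auxExt_of (K : ℕ) (X : ℕ → ℝ) (h0 : X 0 = 0) (i : ℕ) (hi : i ≤ K) :
    auxExt K (fun j => X (j.1 + 1)) i = X i := by
  unfold auxExt
  by_cases h : 1 ≤ i ∧ i ≤ K
  · simp only [h, and_self, dite_true]; rw [Nat.sub_add_cancel h.1]
  · have : i = 0 := by omega
    subst this; simp [h0]

/-- The open set of unnormalized critical points. -/
def auxV (K : ℕ) : Set (Fin K → ℝ) :=
  {x | (∀ j ∈ Finset.range K, auxExt K x j < auxExt K x (j + 1)) ∧
    ∀ j ∈ Finset.range (K - 1),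
      (auxExt K x (j + 2) - auxExt K x (j + 1)) * ∑ i ∈ Finset.Icc 1 K, auxExt K x i
        < auxExt K x (j + 1) * (auxExt K x (j + 1) - auxExt K x j)}

lemma auxV_open (K : ℕ) : IsOpen (auxV K) := by
  have hc := auxExt_cont K
  unfold auxV
  rw [Set.ofPred_and]
  refine IsOpen.inter ?_ ?_
  · simp only [Set.ofPred_forall]
    refine isOpen_biInter_finset fun j _ => isOpen_lt (hc _) (hc _)
  · simp only [Set.ofPred_forall]
    refine isOpen_biInter_finset fun j _ => isOpen_lt ?_ ?_
    · exact ((hc _).sub (hc _)).mul (continuous_finsetSum _ fun i _ => hc i)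
    · exact (hc _).mul ((hc _).sub (hc _))

lemma auxV_nonempty (K : ℕ) (hK : 2 ≤ K) : (auxV K).Nonempty := by
  set e : ℝ := 1 / (4 * K) with he
  have hKr : (2 : ℝ) ≤ K := by exact_mod_cast hK
  have he0 : 0 < e := by positivity
  have heK : e * (2 * K) = 1 / 2 := by rw [he]; field_simp; norm_num
  have he1 : e ≤ 1 / 2 := by nlinarith
  set X : ℕ → ℝ := fun j => ∑ i ∈ Finset.range j, e ^ i with hX
  have hX0 : X 0 = 0 := by simp [hX]
  have hXs : ∀ j, X (j + 1) - X j = e ^ j := by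
    intro j; simp only [hX]; rw [Finset.sum_range_succ]; ring
  have hX1 : ∀ j, 1 ≤ X (j + 1) := by
    intro j
    induction j with
    | zero => simp [hX]
    | succ k ih => have := hXs (k + 1); have := pow_pos he0 (k + 1); linarith
  have hX2 : ∀ j, X j ≤ 2 := by
    intro j
    have : X j ≤ 2 - 2 * e ^ j := by
      induction j with
      | zero => rw [hX0]; norm_num
      | succ k ih =>
        have h1 := hXs k
        have h2 := pow_pos he0 k
        have h3 : e ^ (k + 1) = e ^ k * e := pow_succ _ _
        have h5 : e ^ k * e ≤ e ^ k * (1 / 2) := mul_le_mul_of_nonneg_left he1 h2.le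
        linarith
    have := pow_pos he0 j
    linarith
  refine ⟨fun j => X (j.1 + 1), ?_, ?_⟩
  · intro j hj
    have hj := Finset.mem_range.1 hj
    rw [auxExt_of K X hX0 _ (by omega), auxExt_of K X hX0 _ (by omega)]
    have := hXs j; have := pow_pos he0 j; linarith
  · intro j hj
    have hj := Finset.mem_range.1 hj
    rw [auxExt_of K X hX0 _ (by omega), auxExt_of K X hX0 _ (by omega),
      auxExt_of K X hX0 _ (by omega)]
    have hs : ∑ i ∈ Finset.Icc 1 K, auxExt K (fun j => X (j.1 + 1)) i ≤ 2 * K := by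
      calc _ ≤ ∑ i ∈ Finset.Icc 1 K, (2 : ℝ) := by
            refine Finset.sum_le_sum fun i hi => ?_
            rw [auxExt_of K X hX0 _ (Finset.mem_Icc.1 hi).2]; exact hX2 i
        _ = 2 * K := by simp [mul_comm]
    have h1 := hXs (j + 1)
    have h2 := hXs j
    have h3 := hX1 j
    have h4 := pow_pos he0 j
    rw [h1, h2]
    calc _ ≤ e ^ (j + 1) * (2 * K) := mul_le_mul_of_nonneg_left hs (by positivity)
      _ = e ^ j * (1 / 2) := by rw [pow_succ, mul_assoc, heK]
      _ < 1 * e ^ j := by linarith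
      _ ≤ _ := mul_le_mul_of_nonneg_right h3 h4.le

lemma aux_avoid (K : ℕ) (n : ℕ) (S : Fin n → Submodule ℝ (Fin K → ℝ)) (hS : ∀ m, S m ≠ ⊤)
    (V : Set (Fin K → ℝ)) (hV : IsOpen V) (hne : V.Nonempty) :
    ∃ x ∈ V, ∀ m, x ∉ S m := by
  have h : ∀ᵐ x ∂(MeasureTheory.volume : MeasureTheory.Measure (Fin K → ℝ)), ∀ m, x ∉ S m := by
    rw [MeasureTheory.ae_all_iff]
    intro m
    have := MeasureTheory.Measure.addHaar_submodule
      (MeasureTheory.volume : MeasureTheory.Measure (Fin K → ℝ)) (S m) (hS m)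
    exact MeasureTheory.measure_eq_zero_iff_ae_notMem.1 this
  have hd := MeasureTheory.Measure.dense_of_ae h
  obtain ⟨x, hx, hx'⟩ := hd.inter_open_nonempty V hV hne
  exact ⟨x, hx, hx'⟩

lemma aux_span (K : ℕ) (hK : 2 ≤ K) (A : AffineSubspace ℝ (Fin K → ℝ))
    (hA : Module.finrank ℝ A.direction ≤ K - 2) :
    Submodule.span ℝ (A : Set (Fin K → ℝ)) ≠ ⊤ := by
  intro htop
  have key : ∃ p : Fin K → ℝ, Submodule.span ℝ (A : Set (Fin K → ℝ)) ≤
      A.direction ⊔ Submodule.span ℝ {p} := by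
    rcases (A : Set (Fin K → ℝ)).eq_empty_or_nonempty with h | ⟨p, hp⟩
    · exact ⟨0, by rw [h]; simp⟩
    · refine ⟨p, Submodule.span_le.2 fun x hx => ?_⟩
      have h1 : x - p ∈ A.direction := AffineSubspace.vsub_mem_direction hx hp
      have : x = (x - p) + p := by abel
      rw [this]
      exact Submodule.add_mem_sup h1 (Submodule.mem_span_singleton_self p)
  obtain ⟨p, hp⟩ := key
  have h1 := Submodule.finrank_mono hp
  rw [htop, finrank_top, Module.finrank_fin_fun] at h1
  have h2 := Submodule.finrank_add_le_finrank_add_finrank A.direction (Submodule.span ℝ {p})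
  have h3 : Module.finrank ℝ (Submodule.span ℝ {p}) ≤ 1 := by
    simpa using finrank_span_le_card (R := ℝ) ({p} : Set (Fin K → ℝ))
  omega

/-- For `K ≥ 2`, given any finite collection of affine subspaces of
`ℝ^K` of dimension at most `K−2`, there is a choice of `t ∈ (0,1]^K` such that the
maximizer of `f_t` over the simplex `Δ_K` (viewed as a vector in `ℝ^K`) avoids all
of them. -/
theorem stmt_14
    (K : ℕ) (hK : 2 ≤ K)
    (n : ℕ) (Asub : Fin n → AffineSubspace ℝ (Fin K → ℝ))
    (hdim : ∀ m : Fin n, Module.finrank ℝ (Asub m).direction ≤ K - 2) :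
    ∃ t : ℕ → ℝ, (∀ i ∈ Finset.Icc 1 K, t i ∈ Set.Ioc (0 : ℝ) 1) ∧
      ∀ π : ℕ → ℝ, (∀ i ∈ Finset.Icc 1 K, 0 ≤ π i) →
        (∑ i ∈ Finset.Icc 1 K, π i = 1) →
        (∀ ρ : ℕ → ℝ, (∀ i ∈ Finset.Icc 1 K, 0 ≤ ρ i) →
          (∑ i ∈ Finset.Icc 1 K, ρ i = 1) →
          (∏ i ∈ Finset.Icc 1 K, t i * ρ i) /
              (1 + ∑ j ∈ Finset.Icc 1 K, ∏ i ∈ Finset.Icc 1 j, t i * ρ i)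
            ≤ (∏ i ∈ Finset.Icc 1 K, t i * π i) /
              (1 + ∑ j ∈ Finset.Icc 1 K, ∏ i ∈ Finset.Icc 1 j, t i * π i)) →
        ∀ m : Fin n, (fun i : Fin K => π (i.1 + 1)) ∉ (Asub m : Set (Fin K → ℝ)) := by
  obtain ⟨x, ⟨hx1, hx2⟩, hxA⟩ := aux_avoid K n
    (fun m => Submodule.span ℝ (Asub m : Set (Fin K → ℝ)))
    (fun m => aux_span K hK _ (hdim m)) (auxV K) (auxV_open K) (auxV_nonempty K hK)
  set X := auxExt K x with hX
  have hX0 : X 0 = 0 := by simp [hX, auxExt]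
  have hXpos : ∀ j, j < K → 0 < X (j + 1) := by
    intro j
    induction j with
    | zero => intro h; have := hx1 0 (by simpa using h); rwa [hX0] at this
    | succ k ih => intro h; exact (ih (by omega)).trans (hx1 _ (by simpa using h))
  have hXI : ∀ i ∈ Finset.Icc 1 K, 0 < X i := by
    intro i hi
    simp only [Finset.mem_Icc] at hi
    have := hXpos (i - 1) (by omega)
    rwa [Nat.sub_add_cancel hi.1] at this
  set s := ∑ i ∈ Finset.Icc 1 K, X i with hs
  have hspos : 0 < s := Finset.sum_pos hXI ⟨1, by simp; omega⟩
  set p : ℕ → ℝ := fun i => X i / s with hp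
  have hp0 : p 0 = 0 := by simp [hp, hX0]
  have hpinc : ∀ j < K, p j < p (j + 1) := fun j hj =>
    div_lt_div_of_pos_right (hx1 j (by simpa using hj)) hspos
  have hps : ∑ i ∈ Finset.Icc 1 K, p i = 1 := by
    simp only [hp]; rw [← Finset.sum_div, ← hs, div_self hspos.ne']
  have hpI : ∀ i ∈ Finset.Icc 1 K, 0 < p i := fun i hi => div_pos (hXI i hi) hspos
  set t : ℕ → ℝ := fun j =>
    if j < K then (X (j + 1) - X j) * s / (X j * (X j - X (j - 1))) else 1 with ht
  have htI : ∀ i ∈ Finset.Icc 1 K, t i ∈ Set.Ioc (0 : ℝ) 1 := by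
    intro i hi
    by_cases h : i < K
    · obtain ⟨j, rfl⟩ : ∃ j, i = j + 1 := ⟨i - 1, by simp only [Finset.mem_Icc] at hi; omega⟩
      have a1 := hx1 j (by simp; omega)
      have a2 := hx1 (j + 1) (by simpa using h)
      have a3 := hXI _ hi
      have a4 := hx2 j (by simp; omega)
      have a5 : 0 < X (j + 1) * (X (j + 1) - X j) := mul_pos a3 (sub_pos.2 a1)
      simp only [ht, h, if_true, Nat.add_sub_cancel]
      refine ⟨div_pos (mul_pos (sub_pos.2 a2) hspos) a5, ?_⟩
      rw [div_le_one a5]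
      exact a4.le
    · simp [ht, h]
  refine ⟨t, htI, ?_⟩
  intro π hπ hπs hmax m hm
  have heq := aux_core K (by omega) p t π hp0 hpinc hps (fun i hi => (htI i hi).1) ?_ hπ hπs
    (hmax p (fun i hi => (hpI i hi).le) hps)
  · apply hxA m
    have : x = s • (fun i : Fin K => π (i.1 + 1)) := by
      funext i
      have h1 := heq (i.1 + 1) (by simp only [Finset.mem_Icc]; omega)
      simp only [Pi.smul_apply, smul_eq_mul]
      rw [h1]
      simp only [hp]
      rw [mul_div_cancel₀ _ hspos.ne', hX, auxExt, dif_pos (by omega)]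
      rfl
    rw [this]
    exact Submodule.smul_mem _ _ (Submodule.subset_span hm)
  · intro j hj
    have a1 := hx1 j (by simp; omega)
    have a3 := hXpos j (by omega)
    have a6 : X (j + 1) - X j ≠ 0 := (sub_pos.2 a1).ne'
    simp only [ht, hj, if_true, Nat.add_sub_cancel, hp]
    field_simp
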